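/- In the code-generation model, let j ∈ {1,…,n} and let y be any {0,1}^m-valued random variable that is conditionally independent of the row (X_{j1},…,X_{jm}) given (p_1,…,p_m). Then for every α with 0 < α ≤ 1.7/g1(t) and every real Z: E[exp(α·S_j)] ≤ exp(m·ν·α²), and consequently P[S_j > Z] ≤ exp(m·ν·α² − α·Z). -/

import Mathlib

open MeasureTheory ProbabilityTheory Real

noncomputable section

/-- Bernoulli measure on `Bool` with parameter `p`. -/
def bern (p : ℝ) : Measure Bool :=
  ENNReal.ofReal p • Measure.dirac true + ENNReal.ofReal (1 - p) • Measure.dirac false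

/-- The measure on `ℝ` with density `f` (w.r.t. Lebesgue measure). -/
def biasMeasure (f : ℝ → ℝ) : Measure ℝ :=
  MeasureTheory.volume.withDensity fun p => ENNReal.ofReal (f p)

/-- Joint law of the biases `p = (p_1,…,p_m)` (i.i.d. with density `f`) together with the
code matrix `X` whose entries `X j i` are, conditionally on `p`, independent
Bernoulli(`p i`). -/
def codeMeasure (n m : ℕ) (f : ℝ → ℝ) :
    Measure ((Fin m → ℝ) × (Fin n → Fin m → Bool)) :=
  (Measure.pi fun _ : Fin m => biasMeasure f).bind fun p =>
    (Measure.dirac p).prod (Measure.pi fun _ : Fin n => Measure.pi fun i : Fin m => bern (p i))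

/-- The accusation sum `S_j = Σ_i y_i · (g1 (p_i) if X_{ji} = 1, g0 (p_i) if X_{ji} = 0)`. -/
def accusation (m : ℕ) (g1 g0 : ℝ → ℝ) (p : Fin m → ℝ) (x : Fin m → Bool)
    (y : Fin m → Bool) : ℝ :=
  ∑ i, if y i then (if x i then g1 (p i) else g0 (p i)) else 0


lemma exp_quad_bound {x : ℝ} (hx : x ≤ 1.7) : Real.exp x ≤ 1 + x + x ^ 2 := by
  rcases le_total x (-1) with h | h
  · have : Real.exp x ≤ 1 := Real.exp_le_one_iff.2 (by linarith)
    nlinarith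
  rcases le_total x 1 with h1 | h1
  · have := (abs_le.1 (Real.abs_exp_sub_one_sub_id_le (abs_le.2 ⟨h, h1⟩))).2
    linarith
  obtain ⟨u, rfl⟩ : ∃ u, x = 1 + u := ⟨x - 1, by ring⟩
  have hu0 : 0 ≤ u := by linarith
  have hu1 : u ≤ 0.7 := by norm_num at hx ⊢; linarith
  have hb := Real.exp_bound' hu0 (by norm_num at hu1; linarith) (n := 4) (by norm_num)
  have he := Real.exp_one_lt_d9
  rw [Real.exp_add]
  simp only [Finset.sum_range_succ, Finset.sum_range_zero, Nat.factorial] at hb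
  norm_num at hb hu1 he
  have h2 : u ^ 2 ≤ 7 / 10 * u := by nlinarith
  have h3 : u ^ 3 ≤ 49 / 100 * u := by nlinarith
  have h4 : u ^ 4 ≤ 343 / 1000 * u := by nlinarith
  have hb' : Real.exp u ≤ 1 + u + u ^ 2 / 2 + u ^ 3 / 6 + u ^ 4 * 5 / 96 := by linarith
  calc Real.exp 1 * Real.exp u
      ≤ 2.7182818286 * (1 + u + u ^ 2 / 2 + u ^ 3 / 6 + u ^ 4 * 5 / 96) := by
        apply mul_le_mul _ hb' (Real.exp_pos _).le (by norm_num)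
        norm_num; exact he.le
    _ ≤ 1 + (1 + u) + (1 + u) ^ 2 := by nlinarith

lemma lintegral_pi_prod {E : Type*} [MeasurableSpace E] (m : ℕ) (μ : Fin m → Measure E)
    [∀ i, SigmaFinite (μ i)] (f : Fin m → E → ENNReal) (hf : ∀ i, Measurable (f i)) :
    ∫⁻ x, ∏ i, f i (x i) ∂(Measure.pi μ) = ∏ i, ∫⁻ x, f i x ∂(μ i) := by
  induction m with
  | zero => simp
  | succ m ih =>
    have h := (measurePreserving_piFinSuccAbove μ 0).symm
    rw [← h.lintegral_comp (by fun_prop)]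
    simp only [Fin.prod_univ_succ, MeasurableEquiv.piFinSuccAbove_symm_apply, Fin.insertNthEquiv,
      Equiv.coe_fn_mk, Fin.insertNth_zero', Fin.cons_zero, Fin.cons_succ]
    have := lintegral_prod_mul (μ := μ 0) (ν := Measure.pi fun j => μ (Fin.succAbove 0 j))
      (f := f 0) (g := fun x => ∏ i : Fin m, f i.succ (x i)) (hf 0).aemeasurable
      (Finset.measurable_prod _ fun i _ => (hf i.succ).comp (measurable_pi_apply i)).aemeasurable
    refine this.trans ?_
    congr 1
    exact ih _ _ fun i => hf _

lemma lintegral_pi_le {E : Type*} [MeasurableSpace E] [Nonempty E] (n : ℕ) (μ : Fin n → Measure E)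
    [∀ i, IsProbabilityMeasure (μ i)] (f : (Fin n → E) → ENNReal) (hf : Measurable f)
    (j : Fin n) (C : ENNReal) (h : ∀ x, ∫⁻ e, f (Function.update x j e) ∂(μ j) ≤ C) :
    ∫⁻ x, f x ∂(Measure.pi μ) ≤ C := by
  have x0 : Fin n → E := fun _ => Classical.arbitrary E
  rw [lintegral_eq_lmarginal_univ x0, lmarginal_erase' _ hf (Finset.mem_univ j)]
  refine (lmarginal_mono (g := fun _ => C) h x0).trans ?_
  simp [lmarginal]

instance bern_finite (p : ℝ) : IsFiniteMeasure (bern p) := by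
  constructor
  simp [bern]

lemma bern_prob {p : ℝ} (h0 : 0 ≤ p) (h1 : p ≤ 1) : IsProbabilityMeasure (bern p) := by
  constructor
  simp [bern]
  rw [← ENNReal.ofReal_add h0 (by linarith)]
  simp

lemma lintegral_bern {p : ℝ} (h0 : 0 ≤ p) (h1 : p ≤ 1) (f : Bool → ℝ) (hf : ∀ b, 0 ≤ f b) :
    ∫⁻ b, ENNReal.ofReal (f b) ∂(bern p) = ENNReal.ofReal (p * f true + (1 - p) * f false) := by
  have : 0 ≤ 1 - p := by linarith
  simp only [bern, lintegral_add_measure, lintegral_smul_measure, lintegral_dirac, smul_eq_mul]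
  rw [ENNReal.ofReal_add (mul_nonneg h0 (hf _)) (mul_nonneg this (hf _)),
    ENNReal.ofReal_mul h0, ENNReal.ofReal_mul this]

lemma factor_bound {p a b α : ℝ} (h0 : 0 ≤ p) (h1 : p < 1) (ha : 0 ≤ a) (hα : 0 < α)
    (hb : b = - p * a / (1 - p)) (hαa : α * a ≤ 1.7) :
    p * Real.exp (α * a) + (1 - p) * Real.exp (α * b)
      ≤ 1 + α ^ 2 * (p * a ^ 2 + (1 - p) * b ^ 2) := by
  have h1' : 0 < 1 - p := by linarith
  have hz : p * a + (1 - p) * b = 0 := by rw [hb]; field_simp; ring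
  have hb0 : b ≤ 0 := by
    rw [hb]; apply div_nonpos_of_nonpos_of_nonneg _ h1'.le
    nlinarith [mul_nonneg h0 ha]
  have e1 := exp_quad_bound hαa
  have e2 := exp_quad_bound (x := α * b) (by
    have : α * b ≤ 0 := mul_nonpos_of_nonneg_of_nonpos hα.le hb0
    norm_num; linarith)
  have m1 := mul_le_mul_of_nonneg_left e1 h0
  have m2 := mul_le_mul_of_nonneg_left e2 h1'.le
  have : α * (p * a + (1 - p) * b) = 0 := by rw [hz]; simp
  nlinarith

/-- The per-coordinate second moment. -/
def varAt (g1 g0 : ℝ → ℝ) (p : ℝ) : ℝ := p * g1 p ^ 2 + (1 - p) * g0 p ^ 2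

lemma row_bound (m : ℕ) (t : ℝ) (ht : t ∈ Set.Ioo (0:ℝ) (1/2))
    (g1 : ℝ → ℝ)
    (hg1_pos : ∀ p ∈ Set.Ioo (0:ℝ) 1, 0 < g1 p)
    (hg1_anti : AntitoneOn g1 (Set.Ioo (0:ℝ) 1))
    (g0 : ℝ → ℝ) (hg0 : ∀ p, g0 p = - p * g1 p / (1 - p))
    (α : ℝ) (hα : 0 < α) (hα' : α ≤ 1.7 / g1 t)
    (p : Fin m → ℝ) (hp : ∀ i, p i ∈ Set.Icc t (1 - t)) (y : Fin m → Bool) :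
    ∫⁻ x, ENNReal.ofReal (Real.exp (α * accusation m g1 g0 p x y))
      ∂(Measure.pi fun i => bern (p i)) ≤
    ∏ i, ENNReal.ofReal (1 + α ^ 2 * varAt g1 g0 (p i)) := by
  have h : ∀ x : Fin m → Bool, ENNReal.ofReal (Real.exp (α * accusation m g1 g0 p x y)) =
      ∏ i, (fun b : Bool => ENNReal.ofReal (Real.exp (α *
        (if y i then (if b then g1 (p i) else g0 (p i)) else 0)))) (x i) := by
    intro x
    simp only [accusation, Finset.mul_sum, Real.exp_sum]
    rw [ENNReal.ofReal_prod_of_nonneg (fun i _ => (Real.exp_pos _).le)]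
  simp_rw [h]
  rw [lintegral_pi_prod m (fun i => bern (p i))
    (fun i b => ENNReal.ofReal (Real.exp (α *
        (if y i then (if b then g1 (p i) else g0 (p i)) else 0)))) (fun i => measurable_of_finite _)]
  refine Finset.prod_le_prod' fun i _ => ?_
  obtain ⟨ht0, ht1⟩ := ht
  obtain ⟨hp0, hp1⟩ := hp i
  have hpI : p i ∈ Set.Ioo (0:ℝ) 1 := ⟨by linarith, by linarith⟩
  have htI : t ∈ Set.Ioo (0:ℝ) 1 := ⟨by linarith, by linarith⟩
  rw [lintegral_bern hpI.1.le hpI.2.le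
    (fun b => Real.exp (α * (if y i then (if b then g1 (p i) else g0 (p i)) else 0)))
    (fun b => (Real.exp_pos _).le)]
  apply ENNReal.ofReal_le_ofReal
  by_cases hy : y i
  · simp only [hy, if_true]
    have := factor_bound hpI.1.le hpI.2 (hg1_pos _ hpI).le hα (hg0 (p i)) (by
      rw [le_div_iff₀ (hg1_pos t htI)] at hα'
      exact (mul_le_mul_of_nonneg_left (hg1_anti htI hpI hp0) hα.le).trans hα')
    simpa [varAt] using this
  · simp only [hy, varAt]
    have h1' : 0 ≤ 1 - p i := by linarith
    have := hpI.1.le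
    have : 0 ≤ α ^ 2 * (p i * g1 (p i) ^ 2 + (1 - p i) * g0 (p i) ^ 2) := by positivity
    simp
    linarith

lemma var_lintegral (t : ℝ) (ht : t ∈ Set.Ioo (0:ℝ) (1/2))
    (f : ℝ → ℝ) (hf_meas : Measurable f) (hf_nonneg : ∀ p, 0 ≤ f p)
    (hf_supp : ∀ p, p ∉ Set.Icc t (1-t) → f p = 0)
    (hf_prob : IsProbabilityMeasure (biasMeasure f))
    (g1 : ℝ → ℝ) (hg1_meas : Measurable g1)
    (hg1_pos : ∀ p ∈ Set.Ioo (0:ℝ) 1, 0 < g1 p)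
    (hg1_anti : AntitoneOn g1 (Set.Ioo (0:ℝ) 1))
    (g0 : ℝ → ℝ) (hg0 : ∀ p, g0 p = - p * g1 p / (1 - p))
    (ν : ℝ)
    (hν : ν = ∫ p in Set.Icc t (1-t), f p * (p * g1 p ^ 2 + (1-p) * g0 p ^ 2))
    (α : ℝ) :
    ∫⁻ p, ENNReal.ofReal (1 + α ^ 2 * varAt g1 g0 p) ∂(biasMeasure f)
      = ENNReal.ofReal (1 + α ^ 2 * ν) := by
  obtain ⟨ht0, ht1⟩ := ht
  have hg0_meas : Measurable g0 := by
    rw [show g0 = fun p => - p * g1 p / (1 - p) from funext hg0]; fun_prop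
  have hV_meas : Measurable (varAt g1 g0) := by unfold varAt; fun_prop
  have hV0 : ∀ p ∈ Set.Icc t (1 - t), 0 ≤ varAt g1 g0 p := by
    intro p hp
    have a : 0 ≤ p := by linarith [hp.1]
    have b : 0 ≤ 1 - p := by linarith [hp.2]
    unfold varAt; positivity
  have hVb : ∀ p ∈ Set.Icc t (1 - t), varAt g1 g0 p ≤ g1 t ^ 2 / t := by
    intro p hp
    have hpI : p ∈ Set.Ioo (0:ℝ) 1 := ⟨by linarith [hp.1], by linarith [hp.2]⟩
    have htI : t ∈ Set.Ioo (0:ℝ) 1 := ⟨by linarith, by linarith⟩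
    have b : 0 < 1 - p := by linarith [hp.2]
    have e : varAt g1 g0 p = p * g1 p ^ 2 / (1 - p) := by
      unfold varAt; rw [hg0]; field_simp; ring
    rw [e]
    have hle := hg1_anti htI hpI hp.1
    have hpos := hg1_pos p hpI
    apply div_le_div₀ (by positivity) _ ht0 (by linarith [hp.2])
    have : g1 p ^ 2 ≤ g1 t ^ 2 := by gcongr
    nlinarith [hpI.2, sq_nonneg (g1 p)]
  have hone : ∫⁻ p, ENNReal.ofReal (f p) = 1 := by
    have := hf_prob.measure_univ
    rwa [biasMeasure, withDensity_apply _ MeasurableSet.univ, Measure.restrict_univ] at this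
  have hfi : Integrable f := by
    refine ⟨hf_meas.aestronglyMeasurable, ?_⟩
    rw [hasFiniteIntegral_iff_ofReal (Filter.Eventually.of_forall hf_nonneg), hone]
    simp
  have hf1 : ∫ p, f p = 1 := by
    rw [integral_eq_lintegral_of_nonneg_ae (Filter.Eventually.of_forall hf_nonneg)
      hf_meas.aestronglyMeasurable, hone]; simp
  have hfV : Integrable (fun p => f p * varAt g1 g0 p) := by
    refine (hfi.mul_const (g1 t ^ 2 / t)).mono' (by fun_prop) (Filter.Eventually.of_forall ?_)
    intro p
    by_cases hp : p ∈ Set.Icc t (1 - t)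
    · rw [Real.norm_of_nonneg (mul_nonneg (hf_nonneg p) (hV0 p hp))]
      exact mul_le_mul_of_nonneg_left (hVb p hp) (hf_nonneg p)
    · simp [hf_supp p hp]
  have hν' : ν = ∫ p, f p * varAt g1 g0 p := by
    rw [hν]
    apply setIntegral_eq_integral_of_forall_compl_eq_zero
    intro p hp
    simp [hf_supp p hp]
  rw [biasMeasure, lintegral_withDensity_eq_lintegral_mul _ (by fun_prop) (by fun_prop)]
  have hcongr : ∀ p, ((fun p => ENNReal.ofReal (f p)) *
      fun p => ENNReal.ofReal (1 + α ^ 2 * varAt g1 g0 p)) p =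
      ENNReal.ofReal (f p + α ^ 2 * (f p * varAt g1 g0 p)) := by
    intro p
    simp only [Pi.mul_apply]
    rw [← ENNReal.ofReal_mul (hf_nonneg p)]
    congr 1; ring
  simp_rw [hcongr]
  rw [← ofReal_integral_eq_lintegral_ofReal
    (f := fun p => f p + α ^ 2 * (f p * varAt g1 g0 p)) (hfi.add (hfV.const_mul _))]
  · have : ∫ p, f p + α ^ 2 * (f p * varAt g1 g0 p) = 1 + α ^ 2 * ν := by
      rw [integral_add hfi (hfV.const_mul _), integral_const_mul, hf1, hν']
    exact congrArg _ this
  · refine Filter.Eventually.of_forall fun p => ?_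
    by_cases hp : p ∈ Set.Icc t (1 - t)
    · have := hV0 p hp
      have := hf_nonneg p
      simp only [Pi.zero_apply]; positivity
    · simp [hf_supp p hp]

/-- in the code-generation model, if the pirated word `y` is conditionally
independent of the row of user `j` given the biases `p` (modelled as: `y = ρ p X r` where
`ρ` does not depend on row `j` of `X`, and `r` is independent auxiliary randomness), then
for every `0 < α ≤ 1.7 / g1 t` and every real `Z` we have
`E[exp (α S_j)] ≤ exp (m ν α²)` and `P[S_j > Z] ≤ exp (m ν α² - α Z)`. -/
theorem innocent_mgf_bound
    (n m : ℕ) (hn : 1 ≤ n) (hm : 1 ≤ m)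
    (t : ℝ) (ht : t ∈ Set.Ioo (0:ℝ) (1/2))
    (f : ℝ → ℝ) (hf_meas : Measurable f) (hf_nonneg : ∀ p, 0 ≤ f p)
    (hf_supp : ∀ p, p ∉ Set.Icc t (1-t) → f p = 0)
    (hf_prob : IsProbabilityMeasure (biasMeasure f))
    (g1 : ℝ → ℝ) (hg1_meas : Measurable g1)
    (hg1_pos : ∀ p ∈ Set.Ioo (0:ℝ) 1, 0 < g1 p)
    (hg1_anti : AntitoneOn g1 (Set.Ioo (0:ℝ) 1))
    (g0 : ℝ → ℝ) (hg0 : ∀ p, g0 p = - p * g1 p / (1 - p))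
    (ν : ℝ)
    (hν : ν = ∫ p in Set.Icc t (1-t), f p * (p * g1 p ^ 2 + (1-p) * g0 p ^ 2))
    (Ω' : Type*) [MeasurableSpace Ω'] (μ' : Measure Ω') [IsProbabilityMeasure μ']
    (j : Fin n)
    (ρ : (Fin m → ℝ) → (Fin n → Fin m → Bool) → Ω' → (Fin m → Bool))
    (hρ_meas : Measurable
      (fun q : ((Fin m → ℝ) × (Fin n → Fin m → Bool)) × Ω' => ρ q.1.1 q.1.2 q.2))
    (hρ_indep : ∀ p X X' r, (∀ j' : Fin n, j' ≠ j → X j' = X' j') → ρ p X r = ρ p X' r)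
    (α Z : ℝ) (hα : 0 < α) (hα' : α ≤ 1.7 / g1 t) :
    (∫ q, Real.exp (α * accusation m g1 g0 q.1.1 (q.1.2 j) (ρ q.1.1 q.1.2 q.2))
        ∂((codeMeasure n m f).prod μ')) ≤ Real.exp (m * ν * α ^ 2)
    ∧ ((codeMeasure n m f).prod μ')
        {q | Z < accusation m g1 g0 q.1.1 (q.1.2 j) (ρ q.1.1 q.1.2 q.2)}
        ≤ ENNReal.ofReal (Real.exp (m * ν * α ^ 2 - α * Z)) := by
  have hg0_meas : Measurable g0 := by
    rw [show g0 = fun p => - p * g1 p / (1 - p) from funext hg0]; fun_prop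
  have hacc_meas : Measurable (fun q : ((Fin m → ℝ) × (Fin n → Fin m → Bool)) × Ω' =>
      accusation m g1 g0 q.1.1 (q.1.2 j) (ρ q.1.1 q.1.2 q.2)) := by
    unfold accusation
    refine Finset.measurable_sum _ fun i _ => ?_
    have hy : Measurable (fun q : ((Fin m → ℝ) × (Fin n → Fin m → Bool)) × Ω' =>
      ρ q.1.1 q.1.2 q.2 i) := (measurable_pi_apply i).comp hρ_meas
    have hx : Measurable (fun q : ((Fin m → ℝ) × (Fin n → Fin m → Bool)) × Ω' =>
      q.1.2 j i) := by fun_prop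
    refine Measurable.ite (hy (measurableSet_singleton true)) ?_ measurable_const
    refine Measurable.ite (hx (measurableSet_singleton true)) ?_ ?_ <;> fun_prop
  have hF_meas : Measurable (fun q : ((Fin m → ℝ) × (Fin n → Fin m → Bool)) × Ω' =>
      ENNReal.ofReal (Real.exp (α * accusation m g1 g0 q.1.1 (q.1.2 j) (ρ q.1.1 q.1.2 q.2)))) := by
    fun_prop
  have hsupp : ∀ᵐ p ∂(biasMeasure f), p ∈ Set.Icc t (1 - t) := by
    rw [biasMeasure, ae_withDensity_iff (by fun_prop)]
    refine Filter.Eventually.of_forall fun p h => ?_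
    by_contra hp
    simp [hf_supp p hp] at h
  have hae : ∀ᵐ p ∂(Measure.pi fun _ : Fin m => biasMeasure f), ∀ i, p i ∈ Set.Icc t (1 - t) :=
    Filter.eventually_all.2 fun i => Measure.tendsto_eval_ae_ae.eventually hsupp
  have hV_meas : Measurable (varAt g1 g0) := by unfold varAt; fun_prop
  have hν0 : 0 ≤ ν := by
    rw [hν]
    refine setIntegral_nonneg measurableSet_Icc fun p hp => ?_
    have a : 0 ≤ p := by linarith [hp.1, ht.1]
    have b : 0 ≤ 1 - p := by linarith [hp.2, ht.1]
    have := hf_nonneg p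
    positivity
  have key : ∫⁻ q, ENNReal.ofReal (Real.exp (α *
      accusation m g1 g0 q.1.1 (q.1.2 j) (ρ q.1.1 q.1.2 q.2))) ∂((codeMeasure n m f).prod μ')
      ≤ ENNReal.ofReal (Real.exp (m * ν * α ^ 2)) := by
    rw [lintegral_prod _ hF_meas.aemeasurable, codeMeasure]
    refine (Measure.lintegral_bind_le _ _ _).trans ?_
    calc _ ≤ ∫⁻ p, ∏ i, ENNReal.ofReal (1 + α ^ 2 * varAt g1 g0 (p i))
          ∂(Measure.pi fun _ : Fin m => biasMeasure f) := by
          refine lintegral_mono_ae ?_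
          filter_upwards [hae] with p hp
          have : ∀ i, IsProbabilityMeasure (bern (p i)) := fun i =>
            bern_prob (by linarith [(hp i).1, ht.1]) (by linarith [(hp i).2, ht.1])
          rw [lintegral_prod _ hF_meas.lintegral_prod_right'.aemeasurable, lintegral_dirac]
          have hFp : Measurable (fun z : (Fin n → Fin m → Bool) × Ω' =>
            ENNReal.ofReal (Real.exp (α * accusation m g1 g0 p (z.1 j) (ρ p z.1 z.2)))) :=
            hF_meas.comp (g := fun q : ((Fin m → ℝ) × (Fin n → Fin m → Bool)) × Ω' =>
              ENNReal.ofReal (Real.exp (α *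
                accusation m g1 g0 q.1.1 (q.1.2 j) (ρ q.1.1 q.1.2 q.2))))
              (f := fun z : (Fin n → Fin m → Bool) × Ω' => ((p, z.1), z.2)) (by fun_prop)
          rw [lintegral_lintegral_swap hFp.aemeasurable]
          refine (lintegral_mono (g := fun _ =>
            ∏ i, ENNReal.ofReal (1 + α ^ 2 * varAt g1 g0 (p i))) fun r => ?_).trans ?_
          · refine lintegral_pi_le n _ _ (measurable_of_finite _) j _ fun X => ?_
            have hr : ∀ e, ρ p (Function.update X j e) r = ρ p X r := fun e =>
              hρ_indep _ _ _ _ fun j' hj' => by simp [hj']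
            simp only [hr, Function.update_self]
            exact row_bound m t ht g1 hg1_pos hg1_anti g0 hg0 α hα hα' p hp _
          · simp
      _ = ENNReal.ofReal (1 + α ^ 2 * ν) ^ m := by
          rw [lintegral_pi_prod m (fun _ => biasMeasure f)
            (fun _ p => ENNReal.ofReal (1 + α ^ 2 * varAt g1 g0 p)) (fun i => by fun_prop)]
          simp [var_lintegral t ht f hf_meas hf_nonneg hf_supp hf_prob g1 hg1_meas hg1_pos
            hg1_anti g0 hg0 ν hν α]
      _ ≤ _ := by
          rw [← ENNReal.ofReal_pow (by positivity)]
          apply ENNReal.ofReal_le_ofReal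
          rw [show (m : ℝ) * ν * α ^ 2 = m * (α ^ 2 * ν) by ring, Real.exp_nat_mul]
          gcongr
          linarith [Real.add_one_le_exp (α ^ 2 * ν)]
  refine ⟨?_, ?_⟩
  · rw [integral_eq_lintegral_of_nonneg_ae (Filter.Eventually.of_forall fun _ =>
      (Real.exp_pos _).le)
      (Real.measurable_exp.comp (hacc_meas.const_mul α)).aestronglyMeasurable]
    exact ENNReal.toReal_le_of_le_ofReal (Real.exp_pos _).le key
  · have hmk := meas_ge_le_lintegral_div (μ := (codeMeasure n m f).prod μ') hF_meas.aemeasurable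
      (ε := ENNReal.ofReal (Real.exp (α * Z))) (by simp [Real.exp_pos]) ENNReal.ofReal_ne_top
    refine (measure_mono ?_).trans (hmk.trans ((ENNReal.div_le_div_right key _).trans ?_))
    · intro q hq
      simp only [Set.mem_ofPred_eq] at hq ⊢
      apply ENNReal.ofReal_le_ofReal
      gcongr
    · rw [← ENNReal.ofReal_div_of_pos (Real.exp_pos _), ← Real.exp_sub]

end
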